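/- Let D be a positive integer with D ≡ 0 (mod 4) such that 1 + D is a prime or a prime power (i.e., 1 + D = q^m for some prime q and positive integer m). If r > 1 is an integer and a is an integer such that, in the ring ℤ[√−D], (1 + √−D)^r = a + √−D or (1 + √−D)^r = a − √−D, then D = 4 and r = 3. -/

import Mathlib

namespace OneAddSqrt

lemma step_re (D : ℤ) (n : ℕ) : ((⟨1, 1⟩ : ℤ√(-D)) ^ (n+1)).re =
    ((⟨1, 1⟩ : ℤ√(-D)) ^ n).re - D * ((⟨1, 1⟩ : ℤ√(-D)) ^ n).im := by
  rw [pow_succ, Zsqrtd.re_mul]; ring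

lemma step_im (D : ℤ) (n : ℕ) : ((⟨1, 1⟩ : ℤ√(-D)) ^ (n+1)).im =
    ((⟨1, 1⟩ : ℤ√(-D)) ^ n).re + ((⟨1, 1⟩ : ℤ√(-D)) ^ n).im := by
  rw [pow_succ, Zsqrtd.im_mul]; ring

lemma mod_D (D : ℤ) (n : ℕ) : D ∣ ((⟨1, 1⟩ : ℤ√(-D)) ^ n).re - 1 ∧
    D ∣ ((⟨1, 1⟩ : ℤ√(-D)) ^ n).im - n := by
  induction n with
  | zero => simp
  | succ k ih =>
    rw [step_re, step_im]
    obtain ⟨⟨x, hx⟩, ⟨y, hy⟩⟩ := ih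
    refine ⟨⟨x - ((⟨1, 1⟩ : ℤ√(-D)) ^ k).im, ?_⟩, ⟨x + y, ?_⟩⟩
    · linear_combination hx
    · push_cast
      linear_combination hx + hy

lemma mod_y (D : ℤ) (n : ℕ) : (1 + D) ∣ ((⟨1, 1⟩ : ℤ√(-D)) ^ (n+1)).re - 2 ^ n ∧
    (1 + D) ∣ ((⟨1, 1⟩ : ℤ√(-D)) ^ (n+1)).im - 2 ^ n := by
  induction n with
  | zero => simp
  | succ k ih =>
    rw [step_re D (k+1), step_im D (k+1)]
    obtain ⟨⟨x, hx⟩, ⟨y, hy⟩⟩ := ih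
    refine ⟨⟨x + y - ((⟨1, 1⟩ : ℤ√(-D)) ^ (k+1)).im, ?_⟩, ⟨x + y, ?_⟩⟩
    · linear_combination hx + hy
    · linear_combination hx + hy

lemma two_adic (D : ℤ) (hD : 4 ∣ D) (w : ℕ) (hw : Odd w) (v : ℕ) :
    ∃ c d : ℤ, Odd c ∧ ((⟨1, 1⟩ : ℤ√(-D)) ^ (2 ^ v * w)).im = 2 ^ v * c ∧
      ((⟨1, 1⟩ : ℤ√(-D)) ^ (2 ^ v * w)).re = 1 + 2 ^ (v+1) * d := by
  obtain ⟨E, rfl⟩ := hD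
  induction v with
  | zero =>
    obtain ⟨⟨x, hx⟩, ⟨y, hy⟩⟩ := mod_D (4 * E) w
    obtain ⟨k, rfl⟩ := hw
    refine ⟨_, 2 * E * x, ?_, (one_mul _).symm, ?_⟩
    · simp only [pow_zero, one_mul]
      refine ⟨k + 2 * E * y, ?_⟩
      push_cast at hy
      linear_combination hy
    · simp only [pow_zero, one_mul]
      linear_combination hx
  | succ v ih =>
    obtain ⟨c, d, hc, h1, h2⟩ := ih
    have e : 2 ^ (v+1) * w = 2 ^ v * w + 2 ^ v * w := by ring
    refine ⟨c * (1 + 2 ^ (v+1) * d), d + 2 ^ v * d ^ 2 - E * 2 ^ v * c ^ 2, ?_, ?_, ?_⟩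
    · refine hc.mul ⟨2 ^ v * d, by ring⟩
    · rw [e, pow_add, Zsqrtd.im_mul, h1, h2]; ring
    · rw [e, pow_add, Zsqrtd.re_mul, h1, h2]; ring

lemma jac (N : ℕ) (a x : ℤ) (h : (N : ℤ) ∣ a ^ 2 - x) : jacobiSym x N ≠ -1 := by
  have h1 : x % N = (a ^ 2) % N := (Int.modEq_iff_dvd.mpr h : x ≡ a ^ 2 [ZMOD N])
  rw [jacobiSym.mod_left, h1, ← jacobiSym.mod_left, jacobiSym.pow_left]
  nlinarith [sq_nonneg (jacobiSym a N)]

lemma five_pow (s : ℕ) : (5 ^ 2 ^ (s+4) % 7 = 2 ∨ 5 ^ 2 ^ (s+4) % 7 = 4) ∧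
    5 ^ 2 ^ (s+4) % 17 = 1 ∧ 5 ^ 2 ^ (s+4) % 8 = 1 := by
  induction s with
  | zero => norm_num
  | succ s ih =>
    have e : 5 ^ 2 ^ (s+1+4) = 5 ^ 2 ^ (s+4) * 5 ^ 2 ^ (s+4) := by
      rw [← pow_add]; congr 1; ring
    rw [e]
    generalize 5 ^ 2 ^ (s+4) = x at ih
    obtain ⟨h1, h2, h3⟩ := ih
    refine ⟨?_, ?_, ?_⟩
    · rcases h1 with h1 | h1 <;> simp [Nat.mul_mod, h1]
    · simp [Nat.mul_mod, h2]
    · simp [Nat.mul_mod, h3]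

lemma jac_big (s N : ℕ) (hN : 2 * N = 5 ^ 2 ^ (s+4) + 1) : jacobiSym (-119) N = -1 := by
  obtain ⟨h1, h2, h3⟩ := five_pow s
  generalize 5 ^ 2 ^ (s+4) = x at *
  have n4 : N % 4 = 1 := by omega
  have n17 : N % 17 = 1 := by omega
  have n7 : N % 7 = 5 ∨ N % 7 = 6 := by omega
  have hodd : Odd N := Nat.odd_iff.mpr (by omega)
  have e : (-119 : ℤ) = (-1) * (((7 : ℕ) : ℤ) * ((17 : ℕ) : ℤ)) := by norm_num
  rw [e, jacobiSym.mul_left, jacobiSym.mul_left, jacobiSym.at_neg_one hodd,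
    ZMod.χ₄_nat_one_mod_four n4,
    ← jacobiSym.quadratic_reciprocity_one_mod_four n4 (by decide : Odd 7),
    ← jacobiSym.quadratic_reciprocity_one_mod_four n4 (by decide : Odd 17),
    jacobiSym.mod_left (N : ℤ) 7, jacobiSym.mod_left (N : ℤ) 17]
  have e17 : (N : ℤ) % ((17 : ℕ) : ℤ) = 1 := by omega
  rw [e17]
  rcases n7 with n7 | n7
  · have e7 : (N : ℤ) % ((7 : ℕ) : ℤ) = 5 := by omega
    rw [e7]; norm_num
  · have e7 : (N : ℤ) % ((7 : ℕ) : ℤ) = 6 := by omega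
    rw [e7]; norm_num

/-- reduction of `a² = 5^{mr} - 5^m + 1` modulo divisors of `5^(2^s)+1` -/
lemma red (s w u N : ℕ) (hw : Odd w) (a : ℤ)
    (hN : (N : ℤ) ∣ 5 ^ 2 ^ s + 1)
    (h : a ^ 2 = (5 ^ (1 + 2 ^ s * w)) ^ (3 + 2 ^ (s+2) * u) - 5 ^ (1 + 2 ^ s * w) + 1) :
    (N : ℤ) ∣ a ^ 2 - (-119) := by
  have h0 : (5 : ℤ) ^ 2 ^ s ≡ -1 [ZMOD N] := by
    apply Int.ModEq.symm
    rw [Int.modEq_iff_dvd]; simpa using hN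
  have h1 : (5 : ℤ) ^ (1 + 2 ^ s * w) ≡ -5 [ZMOD N] := by
    rw [pow_add, pow_mul]
    have := (h0.pow w).mul_left (5 ^ 1)
    rw [hw.neg_one_pow] at this
    simpa using this
  have h2 : ((5 : ℤ) ^ (1 + 2 ^ s * w)) ^ (3 + 2 ^ (s+2) * u) ≡ -125 [ZMOD N] := by
    refine (h1.pow _).trans ?_
    have e : (-5 : ℤ) ^ (3 + 2 ^ (s+2) * u) = -125 * (5 ^ 2 ^ s) ^ (4 * u) := by
      have e1 : 2 ^ (s+2) * u = 2 * (2 ^ s * (2 * u)) := by ring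
      rw [pow_add, e1, pow_mul, neg_sq, ← pow_mul, ← pow_mul]
      have e2 : 2 * (2 ^ s * (2 * u)) = 2 ^ s * (4 * u) := by ring
      rw [e2]; norm_num
    rw [e]
    have := (h0.pow (4 * u)).mul_left (-125)
    have e3 : (-1 : ℤ) ^ (4 * u) = 1 := by rw [pow_mul]; norm_num
    rw [e3] at this
    simpa using this
  have h3 := (h2.sub h1).add_right 1
  rw [← h] at h3
  have := h3.symm.dvd
  simpa using this

/-- periodicity reduction -/
lemma red2 (p m r k i : ℕ) (a : ℤ) (hp : (5 : ℤ) ^ 40 ≡ 1 [ZMOD p])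
    (hm : m % 40 = k) (hr : (m * r) % 40 = i)
    (h : a ^ 2 = (5 ^ m) ^ r - 5 ^ m + 1) :
    (p : ℤ) ∣ a ^ 2 - (5 ^ i - 5 ^ k + 1) := by
  have key : ∀ n, (5 : ℤ) ^ n ≡ 5 ^ (n % 40) [ZMOD p] := by
    intro n
    conv_lhs => rw [← Nat.div_add_mod n 40, pow_add, pow_mul]
    have := (hp.pow (n / 40)).mul_right (5 ^ (n % 40))
    simpa using this
  rw [h, ← pow_mul]
  have h3 := (((key (m * r)).sub (key m)).add_right 1).symm.dvd
  rwa [hm, hr] at h3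

lemma s_two (m r : ℕ) (a : ℤ) (hm : m % 8 = 5) (hr : r % 40 = 11)
    (h : a ^ 2 = (5 ^ m) ^ r - 5 ^ m + 1) : False := by
  have hcase : m % 40 = 5 ∨ m % 40 = 13 ∨ m % 40 = 21 ∨ m % 40 = 29 ∨ m % 40 = 37 := by omega
  have p1 : (5 : ℤ) ^ 40 ≡ 1 [ZMOD (41 : ℕ)] := by decide
  have p2 : (5 : ℤ) ^ 40 ≡ 1 [ZMOD (241 : ℕ)] := by decide
  have p3 : (5 : ℤ) ^ 40 ≡ 1 [ZMOD (9161 : ℕ)] := by decide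
  rcases hcase with c | c | c | c | c
  all_goals
    have g : (m * r) % 40 = _ := Nat.mul_mod m r 40
    rw [c, hr] at g
    norm_num at g
    first
    | (refine absurd ?_ (jac _ _ _ (red2 _ m r _ _ a p1 c g h)); norm_num; done)
    | (refine absurd ?_ (jac _ _ _ (red2 _ m r _ _ a p2 c g h)); norm_num; done)
    | (refine absurd ?_ (jac _ _ _ (red2 _ m r _ _ a p3 c g h)); norm_num; done)

lemma final (s w u : ℕ) (hs : 1 ≤ s) (hw : Odd w) (a : ℤ)
    (hr : (3 + 2 ^ (s+2) * u) % 20 = 11)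
    (h : a ^ 2 = (5 ^ (1 + 2 ^ s * w)) ^ (3 + 2 ^ (s+2) * u) - 5 ^ (1 + 2 ^ s * w) + 1) :
    False := by
  have hcases : s = 1 ∨ s = 2 ∨ s = 3 ∨ ∃ t, s = t + 4 := by
    rcases (by omega : s = 1 ∨ s = 2 ∨ s = 3 ∨ 4 ≤ s) with h | h | h | h
    · exact Or.inl h
    · exact Or.inr (Or.inl h)
    · exact Or.inr (Or.inr (Or.inl h))
    · exact Or.inr (Or.inr (Or.inr ⟨s - 4, by omega⟩))
  rcases hcases with rfl | rfl | rfl | ⟨t, rfl⟩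
  · exact jac 13 _ _ (red 1 w u 13 hw a (by norm_num) h) (by norm_num)
  · obtain ⟨k, rfl⟩ := hw
    exact s_two _ _ a (by omega) (by omega) h
  · exact jac 11489 _ _ (red 3 w u 11489 hw a (by norm_num) h) (by norm_num)
  · obtain ⟨-, -, h3⟩ := five_pow t
    obtain ⟨N, hN⟩ : ∃ N, 2 * N = 5 ^ 2 ^ (t+4) + 1 := ⟨(5 ^ 2 ^ (t+4) + 1) / 2, by omega⟩
    refine jac N _ _ (red _ w u N hw a ⟨2, ?_⟩ h) (jac_big t N hN)
    have : ((2 * N : ℕ) : ℤ) = ((5 ^ 2 ^ (t+4) + 1 : ℕ) : ℤ) := by rw [hN]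
    push_cast at this
    linarith

end OneAddSqrt
open OneAddSqrt

theorem one_add_sqrt_neg_D_pow_eq_a_pm_sqrt_neg_D_of_zero_mod_four
    (D : ℤ) (hD : 0 < D) (hDmod : D % 4 = 0)
    (hDpp : ∃ (q : ℕ) (m : ℕ), q.Prime ∧ 0 < m ∧ 1 + D = (q : ℤ) ^ m)
    (r : ℕ) (hr : 1 < r) (a : ℤ)
    (heq : (⟨1, 1⟩ : ℤ√(-D)) ^ r = ⟨a, 1⟩ ∨ (⟨1, 1⟩ : ℤ√(-D)) ^ r = ⟨a, -1⟩) :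
    D = 4 ∧ r = 3 := by
  have h4 : (4 : ℤ) ∣ D := Int.dvd_of_emod_eq_zero hDmod
  rcases heq with heq | heq
  · exfalso
    obtain ⟨v, w, hw, hvw⟩ := Nat.exists_eq_two_pow_mul_odd (n := r - 1) (by omega)
    obtain ⟨c, d, hc, h1, h2⟩ := two_adic D h4 w hw v
    have e := step_im D (r - 1)
    rw [Nat.sub_add_cancel hr.le, heq, hvw, h1, h2] at e
    simp only at e
    have e2 : (2 : ℤ) ^ v * (2 * d + c) = 0 := by rw [pow_succ] at e; linarith
    have e3 : 2 * d + c = 0 := by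
      rcases mul_eq_zero.mp e2 with h | h
      · exact absurd h (by positivity)
      · exact h
    obtain ⟨k, rfl⟩ := hc
    omega
  · have hmodD := (mod_D D r).2
    rw [heq] at hmodD
    simp only at hmodD
    have hr3 : 3 ≤ r := by
      by_contra hlt
      have : r = 2 := by omega
      subst this
      have := h4.trans hmodD
      omega
    -- relation with index r - 3
    have hrel : (1 - 3 * D) * ((⟨1, 1⟩ : ℤ√(-D)) ^ (r-3)).im
        + (3 - D) * (((⟨1, 1⟩ : ℤ√(-D)) ^ (r-3)).re - 1) = D - 4 := by
      obtain ⟨n, rfl⟩ : ∃ n, r = n + 1 + 1 + 1 := ⟨r - 3, by omega⟩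
      have e := step_im D (n+1+1)
      rw [heq] at e
      simp only [step_im, step_re] at e
      have : n + 1 + 1 + 1 - 3 = n := by omega
      rw [this]
      linarith
    have hval : ∀ k : ℕ, (2:ℤ) ^ k ∣ D - 4 → 2 ^ k ∣ r - 3 := by
      intro k hk
      rcases Nat.eq_zero_or_pos (r - 3) with h0 | h0
      · rw [h0]; exact dvd_zero _
      obtain ⟨v, w, hw, hvw⟩ := Nat.exists_eq_two_pow_mul_odd (n := r - 3) (by omega)
      obtain ⟨c, d, hc, h1, h2⟩ := two_adic D h4 w hw v
      rw [hvw, h1, h2] at hrel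
      rw [hvw]
      by_contra hnd
      have hlt : v < k := by
        by_contra hle
        exact hnd (Dvd.dvd.mul_right (pow_dvd_pow 2 (by omega)) _)
      have hk' : (2:ℤ) ^ (v+1) ∣ D - 4 := (pow_dvd_pow 2 hlt).trans hk
      rw [← hrel, pow_succ] at hk'
      have : (2:ℤ) ∣ (1 - 3 * D) * c + (3 - D) * (2 * d) := by
        refine (mul_dvd_mul_iff_left (a := (2:ℤ) ^ v) (by positivity)).mp ?_
        obtain ⟨t, ht⟩ := hk'
        exact ⟨t, by linear_combination ht⟩
      obtain ⟨E, rfl⟩ := h4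
      obtain ⟨j, rfl⟩ := hc
      have h2 : (2:ℤ) ∣ 1 := by
        refine (Int.dvd_add_right (b := 2 * ((j - 3 * 2 * E * (2 * j + 1)) + (3 - 4 * E) * d))
          ⟨_, rfl⟩).mp ?_
        convert this using 1
        ring
      norm_num at h2
    -- norm
    have hnorm : a ^ 2 + D = (1 + D) ^ r := by
      have e := congrArg Zsqrtd.normMonoidHom heq
      rw [map_pow] at e
      simp [Zsqrtd.normMonoidHom, Zsqrtd.norm] at e
      rw [e]; ring
    obtain ⟨q, m, hq, hm, hqm⟩ := hDpp
    have hmody := (mod_y D (r - 1)).2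
    rw [Nat.sub_add_cancel hr.le, heq] at hmody
    simp only at hmody
    -- q = 5
    have hq5 : q = 5 := by
      have : Fact q.Prime := ⟨hq⟩
      have hqd : (q : ℤ) ∣ 1 + D := by rw [hqm]; exact dvd_pow_self _ hm.ne'
      have hq2 : q ≠ 2 := by
        rintro rfl
        omega
      have hfer : (2 : ZMod q) ^ (q - 1) = 1 := by
        apply ZMod.pow_card_sub_one_eq_one
        intro h
        have : ((2 : ℕ) : ZMod q) = 0 := by exact_mod_cast h
        rw [ZMod.natCast_eq_zero_iff] at this
        exact hq2 ((Nat.prime_dvd_prime_iff_eq hq Nat.prime_two).mp this)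
      have hd : (q - 1) ∣ r + 1 := by
        have h1 : ((q : ℤ) - 1) ∣ D := by
          have := sub_one_dvd_pow_sub_one (q : ℤ) m
          rwa [← hqm, add_sub_cancel_left] at this
        have h2 : ((q : ℤ) - 1) ∣ (r : ℤ) + 1 := by
          have := h1.trans hmodD
          obtain ⟨t, ht⟩ := this
          exact ⟨-t, by linear_combination -ht⟩
        have h3 : (((q - 1 : ℕ)) : ℤ) ∣ ((r + 1 : ℕ) : ℤ) := by
          rw [Nat.cast_sub hq.one_le]; push_cast; exact h2
        exact_mod_cast h3
      obtain ⟨k, hk⟩ := hd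
      have h1 : (2 : ZMod q) ^ (r + 1) = 1 := by rw [hk, pow_mul, hfer, one_pow]
      have h2 : (-1 : ZMod q) - 2 ^ (r - 1) = 0 := by
        have := (ZMod.intCast_zmod_eq_zero_iff_dvd _ q).mpr (hqd.trans hmody)
        push_cast at this
        exact this
      have h3 : (2 : ZMod q) ^ (r + 1) = 4 * 2 ^ (r - 1) := by
        have : r + 1 = 2 + (r - 1) := by omega
        rw [this, pow_add]; norm_num
      have h5 : ((5 : ℕ) : ZMod q) = 0 := by
        push_cast
        linear_combination (-4) * h2 + h3 - h1
      rw [ZMod.natCast_eq_zero_iff] at h5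
      exact (Nat.prime_dvd_prime_iff_eq hq Nat.prime_five).mp h5
    subst hq5
    push_cast at hqm
    rcases Nat.lt_or_ge 1 m with hm1 | hm1
    · exfalso
      -- m is odd
      have hmodd : Odd m := by
        rw [← Nat.not_even_iff_odd]
        rintro ⟨k, hk⟩
        have hQ : (5 : ℤ) ^ m = (5 ^ k) ^ 2 := by rw [hk]; ring
        have hQ1 : (1 : ℤ) < 5 ^ k := by
          apply one_lt_pow₀ (by norm_num) (by omega)
        generalize (5 : ℤ) ^ k = Q at *
        have hDQ : D = Q ^ 2 - 1 := by linarith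
        rw [hqm, hQ, hDQ] at hnorm
        have hR : (Q ^ 2) ^ r = (Q ^ r) ^ 2 := by rw [← pow_mul, ← pow_mul, mul_comm]
        have hge : Q ^ 2 ≤ Q ^ r := pow_le_pow_right₀ hQ1.le (by omega)
        rw [hR] at hnorm
        have habs : |a| < Q ^ r := abs_lt_of_sq_lt_sq (by nlinarith) (by positivity)
        rw [← sq_abs] at hnorm
        have := abs_nonneg a
        nlinarith
      obtain ⟨s, w, hw, hsw⟩ := Nat.exists_eq_two_pow_mul_odd (n := m - 1) (by omega)
      have hs : 1 ≤ s := by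
        by_contra h
        have : s = 0 := by omega
        subst this
        obtain ⟨k, rfl⟩ := hmodd
        obtain ⟨j, rfl⟩ := hw
        omega
      have hmsw : m = 1 + 2 ^ s * w := by omega
      have hpow : ∀ s : ℕ, (2:ℤ) ^ (s+2) ∣ 5 ^ 2 ^ s - 1 := by
        intro s
        induction s with
        | zero => norm_num
        | succ s ih =>
          have e : (5:ℤ) ^ 2 ^ (s+1) - 1 = (5 ^ 2 ^ s - 1) * (5 ^ 2 ^ s + 1) := by
            rw [pow_succ 2 s, pow_mul]; ring
          rw [e, show s + 1 + 2 = (s + 2) + 1 from rfl, pow_succ (2:ℤ)]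
          refine mul_dvd_mul ih ?_
          have : Odd ((5:ℤ) ^ 2 ^ s) := Odd.pow (by decide)
          exact (this.add_odd odd_one).two_dvd
      have hD4 : (2:ℤ) ^ (s+2) ∣ D - 4 := by
        have e : D - 4 = 5 * ((5 ^ 2 ^ s) ^ w - 1) := by
          rw [← pow_mul]
          have : D = 5 ^ m - 1 := by linarith
          rw [this, hmsw, pow_add]; ring
        rw [e]
        exact Dvd.dvd.mul_left ((hpow s).trans (sub_one_dvd_pow_sub_one _ w)) _
      obtain ⟨u, hu⟩ := hval _ hD4
      have hru : r = 3 + 2 ^ (s+2) * u := by omega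
      -- r ≡ 11 mod 20
      have hr20 : r % 20 = 11 := by
        have h25 : (25 : ℤ) ∣ -1 - 2 ^ (r - 1) := by
          refine Dvd.dvd.trans ?_ hmody
          rw [hqm]
          exact pow_dvd_pow 5 hm1
        have e : (2:ℤ) ^ (r-1) ≡ 2 ^ ((r-1) % 20) [ZMOD 25] := by
          conv_lhs => rw [← Nat.div_add_mod (r-1) 20, pow_add, pow_mul]
          have hp : (2:ℤ) ^ 20 ≡ 1 [ZMOD 25] := by decide
          have := (hp.pow ((r-1) / 20)).mul_right (2 ^ ((r-1) % 20))
          simpa using this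
        have e2 : (-1 : ℤ) ≡ 2 ^ ((r-1) % 20) [ZMOD 25] := by
          refine Int.ModEq.trans ?_ e
          exact (Int.modEq_iff_dvd.mpr h25).symm
        have hlt : (r-1) % 20 < 20 := Nat.mod_lt _ (by norm_num)
        have : (r-1) % 20 = 10 := by
          revert e2
          generalize (r-1) % 20 = j at hlt
          revert j
          decide
        omega
      rw [hru] at hr20
      refine final s w u hs hw a hr20 ?_
      rw [← hru, ← hmsw]
      rw [hqm] at hnorm
      linarith
    · have : m = 1 := by omega
      subst this
      have hD4 : D = 4 := by linarith
      refine ⟨hD4, ?_⟩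
      have := hval r (by rw [hD4]; simp)
      have h2 : r < 2 ^ r := Nat.lt_two_pow_self
      by_contra hne
      have := Nat.le_of_dvd (by omega) this
      omega
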